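/- In the near-separable setting with m = r, assume r ≥ 2 and ε ≤ σ_min(W)/(8 r √r). Then any optimal solution A* of the minimum-volume-ellipsoid SDP associated with M̃ satisfies λ_min(Wᵀ A* W) ≥ 1/10. -/

import Mathlib

open Matrix BigOperators

/-- Euclidean norm of a vector in `ℝ^m`. -/
noncomputable def colNorm {m : ℕ} (v : Fin m → ℝ) : ℝ := Real.sqrt (∑ i, (v i) ^ 2)

/-- Largest singular value of a matrix. -/
noncomputable def sigmaMax {m n : ℕ} (X : Matrix (Fin m) (Fin n) ℝ) : ℝ :=
  sSup {c : ℝ | ∃ v : Fin n → ℝ, colNorm v = 1 ∧ c = colNorm (X.mulVec v)}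

/-- Smallest singular value of a matrix. -/
noncomputable def sigmaMin {m n : ℕ} (X : Matrix (Fin m) (Fin n) ℝ) : ℝ :=
  sInf {c : ℝ | ∃ v : Fin n → ℝ, colNorm v = 1 ∧ c = colNorm (X.mulVec v)}

/-- Condition number `κ(X) = σ_max(X) / σ_min(X)`. -/
noncomputable def kappa {m n : ℕ} (X : Matrix (Fin m) (Fin n) ℝ) : ℝ :=
  sigmaMax X / sigmaMin X

/-- Largest eigenvalue of a symmetric matrix, via the Rayleigh quotient. -/
noncomputable def lamMax {r : ℕ} (C : Matrix (Fin r) (Fin r) ℝ) : ℝ :=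
  sSup {c : ℝ | ∃ v : Fin r → ℝ, colNorm v = 1 ∧ c = v ⬝ᵥ C.mulVec v}

/-- Smallest eigenvalue of a symmetric matrix, via the Rayleigh quotient. -/
noncomputable def lamMin {r : ℕ} (C : Matrix (Fin r) (Fin r) ℝ) : ℝ :=
  sInf {c : ℝ | ∃ v : Fin r → ℝ, colNorm v = 1 ∧ c = v ⬝ᵥ C.mulVec v}

/-- Near-separable assumption with `m = r`: `Mt = W * H + N` where `W ∈ ℝ^{r×r}` is
invertible, `H = [I_r, H']` is nonnegative with column sums at most one and whose first `r`
columns form the identity matrix, and each column of `N` has Euclidean norm at most `ε`. -/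
def NearSepSquare (r n : ℕ) (W : Matrix (Fin r) (Fin r) ℝ) (H : Matrix (Fin r) (Fin n) ℝ)
    (N Mt : Matrix (Fin r) (Fin n) ℝ) (ε : ℝ) : Prop :=
  IsUnit W.det ∧ Mt = W * H + N ∧ (∀ i j, 0 ≤ H i j) ∧ (∀ j, ∑ i, H i j ≤ 1) ∧
    (∃ h : r ≤ n, ∀ i j : Fin r, H i (Fin.castLE h j) = if i = j then 1 else 0) ∧
    0 ≤ ε ∧ ∀ j, colNorm (fun i => N i j) ≤ ε

/-- `A` is feasible for the minimum-volume-ellipsoid SDP associated with `Mt`: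
`A` is positive semidefinite and `m̃ᵢᵀ A m̃ᵢ ≤ 1` for every column `m̃ᵢ` of `Mt`. -/
def SDPFeasible {r n : ℕ} (Mt : Matrix (Fin r) (Fin n) ℝ)
    (A : Matrix (Fin r) (Fin r) ℝ) : Prop :=
  A.PosSemidef ∧ ∀ j : Fin n, (fun i => Mt i j) ⬝ᵥ A.mulVec (fun i => Mt i j) ≤ 1

/-- `A` is an optimal solution of the minimum-volume-ellipsoid SDP associated with `Mt`:
it is feasible and maximizes the determinant among the feasible matrices. -/
def SDPOptimal {r n : ℕ} (Mt : Matrix (Fin r) (Fin n) ℝ)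
    (A : Matrix (Fin r) (Fin r) ℝ) : Prop :=
  SDPFeasible Mt A ∧ ∀ B : Matrix (Fin r) (Fin r) ℝ, SDPFeasible Mt B → B.det ≤ A.det

lemma colNorm_eq_norm {m : ℕ} (v : Fin m → ℝ) : colNorm v = ‖WithLp.toLp 2 v‖ := by
  simp [colNorm, EuclideanSpace.norm_eq]

lemma colNorm_nonneg {m : ℕ} (v : Fin m → ℝ) : 0 ≤ colNorm v := Real.sqrt_nonneg _

lemma colNorm_sq {m : ℕ} (v : Fin m → ℝ) : colNorm v ^ 2 = v ⬝ᵥ v := by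
  rw [colNorm, Real.sq_sqrt (Finset.sum_nonneg fun i _ => sq_nonneg _)]
  simp [dotProduct, sq]

lemma colNorm_add_le {m : ℕ} (v w : Fin m → ℝ) : colNorm (v + w) ≤ colNorm v + colNorm w := by
  simpa [colNorm_eq_norm] using norm_add_le (WithLp.toLp 2 v) (WithLp.toLp 2 w)

lemma colNorm_smul {m : ℕ} (c : ℝ) (v : Fin m → ℝ) : colNorm (c • v) = |c| * colNorm v := by
  simpa [colNorm_eq_norm] using norm_smul c (WithLp.toLp 2 v)

lemma colNorm_eq_zero {m : ℕ} {v : Fin m → ℝ} : colNorm v = 0 ↔ v = 0 := by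
  simp [colNorm_eq_norm]

lemma colNorm_sum_le {m : ℕ} {ι : Type*} (s : Finset ι) (f : ι → Fin m → ℝ) :
    colNorm (∑ i ∈ s, f i) ≤ ∑ i ∈ s, colNorm (f i) := by
  simpa [colNorm_eq_norm] using norm_sum_le s fun i => WithLp.toLp 2 (f i)

lemma colNorm_le_sum {m : ℕ} {v : Fin m → ℝ} (hv : ∀ i, 0 ≤ v i) : colNorm v ≤ ∑ i, v i :=
  Real.sqrt_le_iff.mpr ⟨Finset.sum_nonneg fun i _ => hv i,
    Finset.sum_sq_le_sq_sum_of_nonneg fun i _ => hv i⟩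

lemma sum_abs_le_sqrt_mul_colNorm {m : ℕ} (v : Fin m → ℝ) :
    ∑ i, |v i| ≤ Real.sqrt m * colNorm v := by
  rw [colNorm, ← Real.sqrt_mul (Nat.cast_nonneg m)]
  apply Real.le_sqrt_of_sq_le
  simpa using sq_sum_le_card_mul_sum_sq (s := Finset.univ) (f := fun i => |v i|)

lemma colNorm_mulVec_le {m n : ℕ} {D : Matrix (Fin m) (Fin n) ℝ} {δ : ℝ}
    (hD : ∀ j, colNorm (fun i => D i j) ≤ δ) (v : Fin n → ℝ) :
    colNorm (D *ᵥ v) ≤ δ * Real.sqrt n * colNorm v := by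
  rcases isEmpty_or_nonempty (Fin n) with h | ⟨⟨j₀⟩⟩
  · have : v = 0 := Subsingleton.elim _ _
    simp [this, colNorm]
  have hδ : 0 ≤ δ := (colNorm_nonneg _).trans (hD j₀)
  have hsum : D *ᵥ v = ∑ j, v j • fun i => D i j := by
    ext i
    simp [mulVec, dotProduct, mul_comm]
  calc colNorm (D *ᵥ v) ≤ ∑ j, colNorm (v j • fun i => D i j) := hsum ▸ colNorm_sum_le _ _
    _ ≤ ∑ j, |v j| * δ := Finset.sum_le_sum fun j _ => by
        rw [colNorm_smul]
        exact mul_le_mul_of_nonneg_left (hD j) (abs_nonneg _)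
    _ = δ * ∑ j, |v j| := by rw [← Finset.sum_mul, mul_comm]
    _ ≤ δ * (Real.sqrt n * colNorm v) :=
        mul_le_mul_of_nonneg_left (sum_abs_le_sqrt_mul_colNorm v) hδ
    _ = _ := by ring

lemma sigmaMin_nonneg {m n : ℕ} (X : Matrix (Fin m) (Fin n) ℝ) : 0 ≤ sigmaMin X :=
  Real.sInf_nonneg (by rintro _ ⟨v, -, rfl⟩; exact colNorm_nonneg _)

lemma sigmaMin_mul_colNorm_le {m n : ℕ} (X : Matrix (Fin m) (Fin n) ℝ) (v : Fin n → ℝ) :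
    sigmaMin X * colNorm v ≤ colNorm (X *ᵥ v) := by
  rcases (colNorm_nonneg v).eq_or_lt with h | h
  · rw [← h, mul_zero]
    exact colNorm_nonneg _
  have hle : sigmaMin X ≤ colNorm (X *ᵥ ((colNorm v)⁻¹ • v)) := by
    refine csInf_le ⟨0, by rintro _ ⟨w, -, rfl⟩; exact colNorm_nonneg _⟩ ⟨_, ?_, rfl⟩
    rw [colNorm_smul, abs_of_pos (inv_pos.mpr h), inv_mul_cancel₀ h.ne']
  rw [mulVec_smul, colNorm_smul, abs_of_pos (inv_pos.mpr h)] at hle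
  calc sigmaMin X * colNorm v ≤ (colNorm v)⁻¹ * colNorm (X *ᵥ v) * colNorm v :=
        mul_le_mul_of_nonneg_right hle h.le
    _ = _ := by field_simp

lemma dotProduct_transpose_mul_mul_mulVec {m n : ℕ} (A : Matrix (Fin m) (Fin m) ℝ)
    (W : Matrix (Fin m) (Fin n) ℝ) (v : Fin n → ℝ) :
    v ⬝ᵥ (Wᵀ * A * W) *ᵥ v = (W *ᵥ v) ⬝ᵥ A *ᵥ (W *ᵥ v) := by
  rw [← mulVec_mulVec, ← mulVec_mulVec, dotProduct_mulVec, vecMul_transpose]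

lemma Matrix.IsHermitian.mul_dotProduct_le {r : ℕ} {M : Matrix (Fin r) (Fin r) ℝ}
    (hM : M.IsHermitian) {a : ℝ} (ha : ∀ k, a ≤ hM.eigenvalues k) (v : Fin r → ℝ) :
    a * (v ⬝ᵥ v) ≤ v ⬝ᵥ M *ᵥ v := by
  have hH : (-algebraMap ℝ (Matrix (Fin r) (Fin r) ℝ) a + M).IsHermitian := by
    refine IsHermitian.add (IsHermitian.neg ?_) hM
    rw [Algebra.algebraMap_eq_smul_one]
    simp [IsHermitian]
  have hP : (-algebraMap ℝ (Matrix (Fin r) (Fin r) ℝ) a + M).PosSemidef := by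
    refine hH.posSemidef_iff_eigenvalues_nonneg.mpr fun i => ?_
    have hi := spectrum.add_mem_iff.mpr (hH.eigenvalues_mem_spectrum_real i)
    rw [hM.spectrum_real_eq_range_eigenvalues] at hi
    obtain ⟨k, hk⟩ := hi
    have := ha k
    simp only [Pi.zero_apply]
    linarith
  have := hP.dotProduct_mulVec_nonneg v
  rw [Algebra.algebraMap_eq_smul_one, add_mulVec, neg_mulVec, smul_mulVec, one_mulVec,
    dotProduct_add, dotProduct_neg, dotProduct_smul, star_trivial, smul_eq_mul] at this
  linarith

lemma Matrix.PosSemidef.pow_le_det {r : ℕ} {M : Matrix (Fin r) (Fin r) ℝ} (hM : M.PosSemidef)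
    {a : ℝ} (ha0 : 0 ≤ a) (ha : ∀ v : Fin r → ℝ, a * (v ⬝ᵥ v) ≤ v ⬝ᵥ M *ᵥ v) :
    a ^ r ≤ M.det := by
  have hle : ∀ k, a ≤ hM.1.eigenvalues k := fun k => by
    have h1 := ha (hM.1.eigenvectorBasis k)
    have hn : (hM.1.eigenvectorBasis k : Fin r → ℝ) ⬝ᵥ hM.1.eigenvectorBasis k = 1 := by
      rw [← colNorm_sq, colNorm_eq_norm]
      simp
    rw [hM.1.mulVec_eigenvectorBasis, dotProduct_smul, hn, smul_eq_mul] at h1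
    linarith
  rw [hM.1.det_eq_prod_eigenvalues]
  calc a ^ r = ∏ _k : Fin r, a := by simp
    _ ≤ _ := Finset.prod_le_prod (fun _ _ => ha0) fun k _ => hle k

lemma Matrix.PosSemidef.det_le_eigenvalue_mul_exp {r : ℕ} {M : Matrix (Fin r) (Fin r) ℝ}
    (hM : M.PosSemidef) (htr : M.trace ≤ r) (k : Fin r) :
    M.det ≤ hM.1.eigenvalues k * Real.exp 1 := by
  set μ := hM.1.eigenvalues with hμ
  have h0 : ∀ i, 0 ≤ μ i := hM.eigenvalues_nonneg
  have hs : ∑ i, μ i ≤ r := by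
    rw [hM.1.trace_eq_sum_eigenvalues] at htr
    simpa using htr
  have hdet : M.det = ∏ i, μ i := by
    rw [hM.1.det_eq_prod_eigenvalues]
    simp [hμ]
  have hsplit : ∑ i ∈ Finset.univ.erase k, (μ i - 1) = ∑ i, (μ i - 1) - (μ k - 1) := by
    rw [← Finset.add_sum_erase _ _ (Finset.mem_univ k)]
    ring
  rw [hdet, ← Finset.mul_prod_erase _ _ (Finset.mem_univ k)]
  refine mul_le_mul_of_nonneg_left ?_ (h0 k)
  calc ∏ i ∈ Finset.univ.erase k, μ i ≤ ∏ i ∈ Finset.univ.erase k, Real.exp (μ i - 1) :=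
        Finset.prod_le_prod (fun i _ => h0 i) fun i _ => by
          linarith [Real.add_one_le_exp (μ i - 1)]
    _ = Real.exp (∑ i ∈ Finset.univ.erase k, (μ i - 1)) := (Real.exp_sum _ _).symm
    _ ≤ Real.exp 1 := by
        rw [Real.exp_le_exp, hsplit, Finset.sum_sub_distrib]
        simp only [Finset.sum_const, Finset.card_univ, Fintype.card_fin, nsmul_eq_mul, mul_one]
        linarith [h0 k]

/-- A positive semidefinite matrix with trace at most its size and determinant at least `9 / 16`
is well conditioned. -/
lemma Matrix.PosSemidef.mul_dotProduct_le_of_trace_le {r : ℕ} {M : Matrix (Fin r) (Fin r) ℝ}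
    (hM : M.PosSemidef) (htr : M.trace ≤ r) (hdet : 9 / 16 ≤ M.det) (v : Fin r → ℝ) :
    1 / 5 * (v ⬝ᵥ v) ≤ v ⬝ᵥ M *ᵥ v := by
  refine hM.1.mul_dotProduct_le (fun k => ?_) v
  have h1 := hM.det_le_eigenvalue_mul_exp htr k
  have h2 := Real.exp_one_lt_d9
  have h3 : hM.1.eigenvalues k * Real.exp 1 ≤ hM.1.eigenvalues k * 2.7182818286 :=
    mul_le_mul_of_nonneg_left h2.le (hM.eigenvalues_nonneg k)
  linarith

lemma three_quarters_le_sq_pow {r : ℕ} {t : ℝ} (ht : t * (8 * r) ≤ 1)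
    (hr : 2 ≤ r) : 3 / 4 ≤ ((1 - t) ^ 2) ^ r := by
  have hr' : (2 : ℝ) ≤ r := by exact_mod_cast hr
  have h := one_add_mul_le_pow (a := -t) (by nlinarith) (2 * r)
  rw [← pow_mul]
  push_cast at h
  rw [← sub_eq_add_neg] at h
  linarith

/-- If `r ≥ 2` and `ε ≤ σ_min(W)/(8 r √r)`, then any optimal solution `A*` of the
minimum-volume-ellipsoid SDP satisfies `λ_min(Wᵀ A* W) ≥ 1/10`. -/
theorem lamMin_lower_bound (r n : ℕ) (W : Matrix (Fin r) (Fin r) ℝ)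
    (H : Matrix (Fin r) (Fin n) ℝ) (N Mt : Matrix (Fin r) (Fin n) ℝ) (ε : ℝ)
    (A : Matrix (Fin r) (Fin r) ℝ)
    (hr : 2 ≤ r) (hsep : NearSepSquare r n W H N Mt ε)
    (hε : ε ≤ sigmaMin W / (8 * r * Real.sqrt r)) (hA : SDPOptimal Mt A) :
    (1 : ℝ) / 10 ≤ lamMin (Wᵀ * A * W) := by
  obtain ⟨hW, rfl, hH0, hH1, ⟨hrn, hHI⟩, hε0, hN⟩ := hsep
  obtain ⟨⟨hApsd, hAfeas⟩, hAopt⟩ := hA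
  have hr' : (2 : ℝ) ≤ r := by exact_mod_cast hr
  have hsr : 1 ≤ Real.sqrt r := Real.one_le_sqrt.mpr (by linarith)
  have hden : 0 < 8 * (r : ℝ) * Real.sqrt r := by positivity
  set δ : ℝ := 1 / (8 * r * Real.sqrt r) with hδ
  have hδ0 : 0 ≤ δ := by positivity
  have hδr : δ * Real.sqrt r * (8 * r) = 1 := by rw [hδ]; field_simp
  have hδη : δ ≤ δ * Real.sqrt r := le_mul_of_one_le_right hδ0 hsr
  set η : ℝ := δ * Real.sqrt r with hη
  have hη0 : 0 ≤ η := hδ0.trans hδη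
  have hη16 : η ≤ 1 / 16 := by nlinarith
  -- Pull everything back through `W`.
  set D : Matrix (Fin r) (Fin n) ℝ := W⁻¹ * N with hD
  set C : Matrix (Fin r) (Fin r) ℝ := Wᵀ * A * W with hC
  have hWD : W * D = N := by rw [hD, ← Matrix.mul_assoc, mul_nonsing_inv _ hW, Matrix.one_mul]
  have hDcol : ∀ j, colNorm (fun i => D i j) ≤ δ := fun j => by
    have hcol : W *ᵥ (fun i => D i j) = fun i => N i j := by
      ext i
      rw [← hWD]
      rfl
    have h1 := sigmaMin_mul_colNorm_le W (fun i => D i j)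
    rw [hcol] at h1
    rcases (sigmaMin_nonneg W).eq_or_lt with hs | hs
    · rw [← hs, zero_div] at hε
      have hN0 : colNorm (fun i => N i j) = 0 :=
        le_antisymm ((hN j).trans hε) (colNorm_nonneg _)
      have hz := colNorm_eq_zero.mp hN0
      rw [← hcol] at hz
      have hz' : (fun i => D i j) = 0 :=
        (mulVec_injective_iff_isUnit.mpr ((isUnit_iff_isUnit_det W).mpr hW))
          (hz.trans (mulVec_zero W).symm)
      rw [colNorm_eq_zero.mpr hz']
      exact hδ0
    · have h2 : sigmaMin W * colNorm (fun i => D i j) ≤ sigmaMin W * δ := by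
        refine (h1.trans (hN j)).trans (hε.trans_eq ?_)
        rw [hδ]
        ring
      exact le_of_mul_le_mul_left h2 hs
  have hMcol : ∀ j, (fun i => (W * H + N) i j) = W *ᵥ (fun i => (H + D) i j) := fun j => by
    ext i
    rw [← hWD, ← Matrix.mul_add]
    rfl
  have hXnorm : ∀ j, colNorm (fun i => (H + D) i j) ≤ 1 + δ := fun j =>
    (colNorm_add_le (fun i => H i j) (fun i => D i j)).trans
      (add_le_add ((colNorm_le_sum fun i => hH0 i j).trans (hH1 j)) (hDcol j))
  have hCpsd : C.PosSemidef := by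
    simpa using hApsd.conjTranspose_mul_mul_same W
  have hCfeas : ∀ j, (fun i => (H + D) i j) ⬝ᵥ C *ᵥ (fun i => (H + D) i j) ≤ 1 := fun j => by
    rw [hC, dotProduct_transpose_mul_mul_mulVec, ← hMcol]
    exact hAfeas j
  -- A scaled copy of `(W Wᵀ)⁻¹` is feasible, which bounds `det C` from below.
  set c : ℝ := (1 - δ) ^ 2 with hc
  have hBfeas : SDPFeasible (W * H + N) (c • ((W⁻¹)ᵀ * W⁻¹)) := by
    refine ⟨?_, fun j => ?_⟩
    · refine PosSemidef.smul ?_ (sq_nonneg _)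
      simpa using posSemidef_conjTranspose_mul_self W⁻¹
    · rw [hMcol, smul_mulVec, dotProduct_smul, ← Matrix.mul_one (W⁻¹)ᵀ,
        dotProduct_transpose_mul_mul_mulVec, one_mulVec, mulVec_mulVec, nonsing_inv_mul _ hW,
        one_mulVec, ← colNorm_sq, smul_eq_mul, hc, ← mul_pow]
      have h0 := colNorm_nonneg (fun i => (H + D) i j)
      have h1 := hXnorm j
      have h2 : 0 ≤ 1 - δ := by linarith
      refine pow_le_one₀ (mul_nonneg h2 h0) ?_
      nlinarith
  have hCdet : 3 / 4 ≤ C.det := by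
    have h1 := hAopt _ hBfeas
    have hW2 : 0 ≤ W.det ^ 2 := sq_nonneg _
    have hWi : W⁻¹.det * W.det = 1 := by
      rw [← det_mul, nonsing_inv_mul _ hW, det_one]
    have h2 : C.det = A.det * W.det ^ 2 := by
      rw [hC, det_mul, det_mul, det_transpose]
      ring
    have h3 : (c • ((W⁻¹)ᵀ * W⁻¹)).det * W.det ^ 2 = c ^ r := by
      rw [det_smul, det_mul, det_transpose, Fintype.card_fin]
      linear_combination c ^ r * (W⁻¹.det * W.det + 1) * hWi
    have h4 : 3 / 4 ≤ c ^ r := three_quarters_le_sq_pow (by nlinarith) hr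
    rw [h2]
    exact h4.trans (h3 ▸ mul_le_mul_of_nonneg_right h1 hW2)
  -- The first `r` columns form a perturbation `E` of the identity.
  set F : Matrix (Fin r) (Fin r) ℝ := D.submatrix id (Fin.castLE hrn) with hF
  set E : Matrix (Fin r) (Fin r) ℝ := 1 + F with hE
  have hFv : ∀ v, colNorm (F *ᵥ v) ≤ η * colNorm v :=
    colNorm_mulVec_le fun j => hDcol (Fin.castLE hrn j)
  have hEv : ∀ v, E *ᵥ v = v + F *ᵥ v := fun v => by rw [hE, add_mulVec, one_mulVec]
  have hEupper : ∀ v, colNorm (E *ᵥ v) ≤ (1 + η) * colNorm v := fun v => by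
    rw [hEv]
    linarith [colNorm_add_le v (F *ᵥ v), hFv v]
  have hElower : ∀ v, (1 - η) * colNorm v ≤ colNorm (E *ᵥ v) := fun v => by
    have h1 := colNorm_add_le (E *ᵥ v) ((-1 : ℝ) • F *ᵥ v)
    have h2 : E *ᵥ v + (-1 : ℝ) • F *ᵥ v = v := by rw [hEv]; simp
    rw [h2, colNorm_smul, abs_neg, abs_one, one_mul] at h1
    linarith [hFv v]
  have hEdet : 3 / 4 ≤ E.det ^ 2 := by
    have hP : (Eᵀ * E).PosSemidef := by simpa using posSemidef_conjTranspose_mul_self E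
    have h := hP.pow_le_det (sq_nonneg (1 - η)) fun v => by
      rw [← Matrix.mul_one Eᵀ, dotProduct_transpose_mul_mul_mulVec, one_mulVec, ← colNorm_sq,
        ← colNorm_sq, ← mul_pow]
      exact pow_le_pow_left₀ (mul_nonneg (by linarith) (colNorm_nonneg v)) (hElower v) 2
    rw [det_mul, det_transpose, ← sq] at h
    exact (three_quarters_le_sq_pow hδr.le hr).trans h
  have hEunit : IsUnit E.det := by
    rw [isUnit_iff_ne_zero]
    intro h
    norm_num [h] at hEdet
  have hGpsd : (Eᵀ * C * E).PosSemidef := by simpa using hCpsd.conjTranspose_mul_mul_same E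
  have hGtr : (Eᵀ * C * E).trace ≤ r := by
    have hdiag : ∀ j, (Eᵀ * C * E) j j ≤ 1 := fun j => by
      have hcol : E *ᵥ Pi.single j 1 = fun i => (H + D) i (Fin.castLE hrn j) := by
        ext i
        simp [hE, hF, hHI, Matrix.one_apply]
      have h := hCfeas (Fin.castLE hrn j)
      rw [← hcol, ← dotProduct_transpose_mul_mul_mulVec] at h
      simpa using h
    calc (Eᵀ * C * E).trace ≤ ∑ _j : Fin r, (1 : ℝ) := Finset.sum_le_sum fun j _ => hdiag j
      _ = r := by simp
  have hGdet : 9 / 16 ≤ (Eᵀ * C * E).det := by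
    rw [det_mul, det_mul, det_transpose]
    nlinarith
  refine le_csInf ⟨_, Pi.single ⟨0, by omega⟩ 1, ?_, rfl⟩ ?_
  · simp [colNorm_eq_norm]
  rintro _ ⟨v, hv, rfl⟩
  set u := E⁻¹ *ᵥ v with hu
  have hEu : E *ᵥ u = v := by rw [hu, mulVec_mulVec, mul_nonsing_inv _ hEunit, one_mulVec]
  have h1 := hGpsd.mul_dotProduct_le_of_trace_le hGtr hGdet u
  rw [dotProduct_transpose_mul_mul_mulVec, hEu, ← colNorm_sq] at h1
  have h2 := hEupper u
  rw [hEu, hv] at h2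
  have h3 := colNorm_nonneg u
  have h4 : 16 / 17 ≤ colNorm u := by nlinarith
  nlinarith
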